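/- (Lemma 2.1, volume growth of sections.) Assume λ ≤ det D²u ≤ Λ in Ω. Then there are constants c₁ > 0 and C₁ > 0 depending only on n, λ, Λ such that for every x ∈ Ω and t > 0 with S_u(x, t) ⊂⊂ Ω, the Lebesgue measure of the section satisfies c₁ t^{n/2} ≤ |S_u(x, t)| ≤ C₁ t^{n/2}. -/

import Mathlib

open MeasureTheory

noncomputable section

/-- Euclidean space `ℝⁿ`. -/
abbrev E (n : ℕ) := EuclideanSpace ℝ (Fin n)

/-- First partial derivative `∂_i f (x)`. -/
noncomputable def pd {n : ℕ} (f : E n → ℝ) (x : E n) (i : Fin n) : ℝ :=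
  fderiv ℝ f x (EuclideanSpace.single i 1)

/-- Second partial derivative `∂_{ij} f (x)`. -/
noncomputable def pd2 {n : ℕ} (f : E n → ℝ) (x : E n) (i j : Fin n) : ℝ :=
  fderiv ℝ (fun y => fderiv ℝ f y (EuclideanSpace.single j 1)) x (EuclideanSpace.single i 1)

/-- Hessian matrix `D²f(x)`. -/
noncomputable def Hess {n : ℕ} (f : E n → ℝ) (x : E n) : Matrix (Fin n) (Fin n) ℝ :=
  Matrix.of fun i j => pd2 f x i j

/-- The cofactor matrix `U = (det D²u)(D²u)⁻¹` of the Hessian of `u`,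
realized as the adjugate. -/
noncomputable def cofU {n : ℕ} (u : E n → ℝ) (x : E n) : Matrix (Fin n) (Fin n) ℝ :=
  (Hess u x).adjugate

/-- Section of the convex function `u`:
`S_u(x₀,t) = {x ∈ cl Ω : u x < u x₀ + ∇u(x₀)·(x - x₀) + t}`. -/
def MASection {n : ℕ} (Ω : Set (E n)) (u : E n → ℝ) (x₀ : E n) (t : ℝ) : Set (E n) :=
  {x ∈ closure Ω | u x < u x₀ + fderiv ℝ u x₀ (x - x₀) + t}

/-- `A ⊂⊂ B`: the closure of `A` is a compact subset of `B`. -/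
def CptIn {n : ℕ} (A B : Set (E n)) : Prop :=
  IsCompact (closure A) ∧ closure A ⊆ B

/-- Uniform convexity of a domain: balls of radius proportional to `‖x - y‖²`
centered at midpoints of points of the closure stay in the closure. -/
def UnifConvex {n : ℕ} (Ω : Set (E n)) : Prop :=
  ∃ δ > 0, ∀ x ∈ closure Ω, ∀ y ∈ closure Ω,
    Metric.closedBall (midpoint ℝ x y) (δ * ‖x - y‖ ^ 2) ⊆ closure Ω

/-- Standing assumptions: `Ω` is a bounded, open, nonempty, uniformly convex domain and
`u` is a smooth convex function on `cl Ω` vanishing on `∂Ω`. -/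
def MASetup {n : ℕ} (Ω : Set (E n)) (u : E n → ℝ) : Prop :=
  IsOpen Ω ∧ Bornology.IsBounded Ω ∧ Ω.Nonempty ∧ UnifConvex Ω ∧
  ContDiffOn ℝ (⊤ : ℕ∞) u (closure Ω) ∧ ConvexOn ℝ (closure Ω) u ∧
  ∀ x ∈ frontier Ω, u x = 0

/-- `λ ≤ det D²u ≤ Λ` in `Ω`. -/
def DetBounds {n : ℕ} (Ω : Set (E n)) (u : E n → ℝ) (lam Lam : ℝ) : Prop :=
  ∀ x ∈ Ω, lam ≤ (Hess u x).det ∧ (Hess u x).det ≤ Lam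

/-- The Monge-Ampère measure of `u`: `μ(A) = ∫_A det D²u`. -/
noncomputable def maMeasure {n : ℕ} (u : E n → ℝ) (A : Set (E n)) : ℝ :=
  ∫ x in A, (Hess u x).det

/-- Center of mass of a set. -/
noncomputable def centerOfMass {n : ℕ} (S : Set (E n)) : E n :=
  (volume S).toReal⁻¹ • ∫ x in S, x

/-- The `α`-dilation of `S` with respect to its center of mass. -/
def dilateCM {n : ℕ} (α : ℝ) (S : Set (E n)) : Set (E n) :=
  (fun x => centerOfMass S + α • (x - centerOfMass S)) '' S

/-- The Monge-Ampère measure of `u` is doubling with respect to the center of mass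
on the sections of `u`, with constants `0 < α < 1 < β`. -/
def DoublingCM {n : ℕ} (Ω : Set (E n)) (u : E n → ℝ) (α β : ℝ) : Prop :=
  0 < α ∧ α < 1 ∧ 1 < β ∧
  ∀ x₀ ∈ Ω, ∀ t : ℝ, 0 < t → CptIn (MASection Ω u x₀ t) Ω →
    maMeasure u (MASection Ω u x₀ t) ≤ β * maMeasure u (dilateCM α (MASection Ω u x₀ (t / 2)))

/-- `g` is a Green's function of the linearized Monge-Ampère operator `L_u` in `V`
with pole `y`: positive and smooth on `V \ {y}`, `L_u`-harmonic there, vanishing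
continuously on `∂V`, and `∫_V g · (L_u φ) = φ(y)` (i.e. `∫_V g · U^{ij}∂_{ij}φ = -φ(y)`)
for all test functions `φ`. -/
def IsGreen {n : ℕ} (u : E n → ℝ) (V : Set (E n)) (y : E n) (g : E n → ℝ) : Prop :=
  (∀ x ∈ V \ {y}, 0 < g x) ∧
  ContDiffOn ℝ (⊤ : ℕ∞) g (V \ {y}) ∧
  (∀ x ∈ V \ {y}, ∑ i, ∑ j, cofU u x i j * pd2 g x i j = 0) ∧
  ContinuousOn g (closure V \ {y}) ∧
  (∀ x ∈ frontier V, g x = 0) ∧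
  ∀ φ : E n → ℝ, ContDiff ℝ (⊤ : ℕ∞) φ → HasCompactSupport φ → tsupport φ ⊆ V →
    (∫ x in V, g x * ∑ i, ∑ j, cofU u x i j * pd2 φ x i j) = -φ y

/-- Capacity of a compact set `K` relative to `V` for the operator `L_u`:
the infimum of `∫_V U^{ij} ∂_iΦ ∂_jΦ` over Lipschitz `Φ` compactly supported in `V`
with `Φ ≥ 1` on `K`. -/
noncomputable def capacity {n : ℕ} (u : E n → ℝ) (K V : Set (E n)) : ℝ :=
  sInf { e : ℝ | ∃ Φ : E n → ℝ, (∃ L : NNReal, LipschitzWith L Φ) ∧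
    HasCompactSupport Φ ∧ tsupport Φ ⊆ V ∧ (∀ x ∈ K, 1 ≤ Φ x) ∧
    e = ∫ x in V, ∑ i, ∑ j, cofU u x i j * pd Φ x i * pd Φ x j }

theorem ConvexOn.add_fderiv_le {F : Type*} [NormedAddCommGroup F] [NormedSpace ℝ F] {s : Set F}
    {f : F → ℝ} {f' : F →L[ℝ] ℝ} {y z : F} (hf : ConvexOn ℝ s f) (hy : y ∈ s) (hz : z ∈ s)
    (hd : HasFDerivAt f f' y) : f y + f' (z - y) ≤ f z := by
  have hc := hf.comp_affineMap (AffineMap.lineMap y z : ℝ →ᵃ[ℝ] F)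
  have hd' : HasDerivAt (f ∘ (AffineMap.lineMap y z : ℝ →ᵃ[ℝ] F)) (f' (z - y)) 0 := by
    refine HasFDerivAt.comp_hasDerivAt (x := (0 : ℝ)) (l := f) (l' := f') ?_
      AffineMap.hasDerivAt_lineMap
    simpa using hd
  have := hc.le_slope_of_hasDerivAt (x := 0) (y := 1) (by simpa using hy) (by simpa using hz)
    one_pos hd'
  simp only [slope, sub_zero, inv_one, Function.comp_apply, AffineMap.lineMap_apply_one,
    AffineMap.lineMap_apply_zero, vsub_eq_sub, one_smul] at this
  linarith

/-- The gradient of `u` as a vector of partial derivatives. -/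
def gradVec {n : ℕ} (u : E n → ℝ) (y : E n) : E n := WithLp.toLp 2 fun j => pd u y j

theorem fderiv_eq_dotProduct_gradVec {n : ℕ} (u : E n → ℝ) (y w : E n) :
    fderiv ℝ u y w = w.ofLp ⬝ᵥ (gradVec u y).ofLp := by
  conv_lhs => rw [← (EuclideanSpace.basisFun (Fin n) ℝ).sum_repr w]
  simp [dotProduct, gradVec, pd]

theorem hasFDerivAt_gradVec {n : ℕ} {u : E n → ℝ} {y : E n} (hu : ContDiffAt ℝ 2 u y) :
    HasFDerivAt (gradVec u) (Matrix.toEuclideanCLM (𝕜 := ℝ) (Hess u y).transpose) y := by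
  rw [← hasFDerivWithinAt_univ, hasFDerivWithinAt_euclidean]
  intro j
  rw [hasFDerivWithinAt_univ]
  have h1 : DifferentiableAt ℝ (fderiv ℝ u) y :=
    (hu.fderiv_right (m := 1) (by norm_num)).differentiableAt (by norm_num)
  have h2 : DifferentiableAt ℝ (fun y => fderiv ℝ u y (EuclideanSpace.single j 1)) y :=
    h1.clm_apply (differentiableAt_const _)
  refine h2.hasFDerivAt.congr_fderiv ?_
  ext w
  conv_lhs => rw [← (EuclideanSpace.basisFun (Fin n) ℝ).sum_repr w]
  simp [Matrix.mulVec, dotProduct, Hess, pd2, mul_comm]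

theorem det_toEuclideanCLM {n : ℕ} (M : Matrix (Fin n) (Fin n) ℝ) :
    (Matrix.toEuclideanCLM (𝕜 := ℝ) M).det = M.det := by
  rw [ContinuousLinearMap.det, Matrix.coe_toEuclideanCLM_eq_toEuclideanLin]
  simp

/-- The gradient map of a convex function with nonsingular Hessian is injective. -/
theorem gradVec_injOn {n : ℕ} {u : E n → ℝ} {Ω K s : Set (E n)} (hΩ : IsOpen Ω)
    (hu : ContDiffOn ℝ 2 u Ω) (hc : ConvexOn ℝ s u) (hs : Ω ⊆ s) (hK : Convex ℝ K) (hKΩ : K ⊆ Ω)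
    (hdet : ∀ x ∈ Ω, (Hess u x).det ≠ 0) : Set.InjOn (gradVec u) K := by
  intro y hy z hz hyz
  by_contra hne
  have hat : ∀ w ∈ Ω, ContDiffAt ℝ 2 u w := fun w hw => hu.contDiffAt (hΩ.mem_nhds hw)
  have hfd : ∀ w ∈ Ω, HasFDerivAt u (fderiv ℝ u w) w := fun w hw =>
    ((hat w hw).differentiableAt (by norm_num)).hasFDerivAt
  have hp : fderiv ℝ u y = fderiv ℝ u z := by
    ext w; rw [fderiv_eq_dotProduct_gradVec, fderiv_eq_dotProduct_gradVec, hyz]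
  have hle : ∀ w ∈ Ω, u y + fderiv ℝ u y (w - y) ≤ u w := fun w hw =>
    hc.add_fderiv_le (hs (hKΩ hy)) (hs hw) (hfd y (hKΩ hy))
  have hzy : u z + fderiv ℝ u y (y - z) ≤ u y := by
    rw [hp]; exact hc.add_fderiv_le (hs (hKΩ hz)) (hs (hKΩ hy)) (hfd z (hKΩ hz))
  have hconst : ∀ r ∈ Set.Icc (0 : ℝ) 1, gradVec u (AffineMap.lineMap y z r) = gradVec u y := by
    intro r hr
    have hwK : (AffineMap.lineMap y z r : E n) ∈ K := hK.lineMap_mem hy hz hr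
    have hup : u (AffineMap.lineMap y z r) ≤ (1 - r) * u y + r * u z := by
      rw [AffineMap.lineMap_apply_module]
      exact hc.2 (hs (hKΩ hy)) (hs (hKΩ hz)) (by linarith [hr.2]) hr.1 (by ring)
    have hdir : fderiv ℝ u y (AffineMap.lineMap y z r - y) = r * fderiv ℝ u y (z - y) := by
      rw [AffineMap.lineMap_apply]; simp
    have hneg : fderiv ℝ u y (y - z) = - fderiv ℝ u y (z - y) := by
      rw [← map_neg, neg_sub]
    set w : E n := AffineMap.lineMap y z r
    have hmin : IsLocalMin (fun v => u v - fderiv ℝ u y (v - y)) w := by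
      filter_upwards [hΩ.mem_nhds (hKΩ hwK)] with v hv
      have := hle v hv
      rw [hdir]
      nlinarith [hr.1, hr.2]
    have hd : HasFDerivAt (fun v => u v - fderiv ℝ u y (v - y))
        (fderiv ℝ u w - fderiv ℝ u y) w :=
      (hfd w (hKΩ hwK)).sub
        ((fderiv ℝ u y).hasFDerivAt.comp w ((hasFDerivAt_id w).sub_const y))
    have h0 := hmin.hasFDerivAt_eq_zero hd
    ext j
    simp only [gradVec, pd]
    rw [sub_eq_zero.1 h0]
  have hd : HasDerivAt (gradVec u ∘ (AffineMap.lineMap y z : ℝ →ᵃ[ℝ] E n))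
      (Matrix.toEuclideanCLM (𝕜 := ℝ) (Hess u y).transpose (z - y)) 0 := by
    refine HasFDerivAt.comp_hasDerivAt (x := (0 : ℝ)) (l := gradVec u)
      (l' := Matrix.toEuclideanCLM (𝕜 := ℝ) (Hess u y).transpose) ?_ AffineMap.hasDerivAt_lineMap
    simpa using hasFDerivAt_gradVec (hat y (hKΩ hy))
  have hd0 : HasDerivWithinAt (gradVec u ∘ (AffineMap.lineMap y z : ℝ →ᵃ[ℝ] E n)) 0
      (Set.Icc 0 1) 0 :=
    (hasDerivWithinAt_const (0 : ℝ) (Set.Icc (0 : ℝ) 1) (gradVec u y)).congr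
      (fun r hr => hconst r hr) (by simp)
  have hzero := (uniqueDiffOn_Icc (zero_lt_one' ℝ) 0 (by simp)).eq_deriv _
    hd.hasDerivWithinAt hd0
  have hmv : (Hess u y).transpose.mulVec (z - y).ofLp = 0 := by
    simpa [Matrix.mulVec_sub] using congrArg WithLp.ofLp hzero
  have := Matrix.eq_zero_of_mulVec_eq_zero
    (by rw [Matrix.det_transpose]; exact hdet y (hKΩ hy)) hmv
  apply hne
  ext i
  have := congrFun this i
  simp at this
  linarith

/-- A compact set with nonempty interior contains the vertices of a nondegenerate simplex whose
associated parallelepiped contains the set (take a simplex of maximal volume). -/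
theorem IsCompact.exists_simplex {n : ℕ} {K : Set (E n)} (hK : IsCompact K)
    (hi : (interior K).Nonempty) :
    ∃ v₀ ∈ K, ∃ M : Matrix (Fin n) (Fin n) ℝ, M.det ≠ 0 ∧
      (∀ i, v₀ + WithLp.toLp 2 (M.col i) ∈ K) ∧
      ∀ z ∈ K, ∃ a : Fin n → ℝ, (∀ i, |a i| ≤ 1) ∧ z = v₀ + WithLp.toLp 2 (M.mulVec a) := by
  let A : E n × (Fin n → E n) → Matrix (Fin n) (Fin n) ℝ :=
    fun q => Matrix.of fun i j => (q.2 j - q.1) i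
  let D : Set (E n × (Fin n → E n)) := K ×ˢ Set.univ.pi fun _ => K
  have hD : IsCompact D := hK.prod (isCompact_univ_pi fun _ => hK)
  obtain ⟨p, hp⟩ := hi
  obtain ⟨r, hr, hball⟩ := Metric.isOpen_iff.1 isOpen_interior p hp
  have hpK := interior_subset hp
  let q₀ : E n × (Fin n → E n) := (p, fun j => p + EuclideanSpace.single j (r / 2))
  have hq₀ : q₀ ∈ D := by
    refine ⟨hpK, fun j _ => interior_subset (hball ?_)⟩
    simp [q₀, abs_of_pos hr]
    linarith
  have hA : Continuous A := by
    refine continuous_matrix fun i j => ?_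
    simp only [A, Matrix.of_apply]
    fun_prop
  have hdet₀ : (A q₀).det ≠ 0 := by
    have : A q₀ = (r / 2) • (1 : Matrix (Fin n) (Fin n) ℝ) := by
      ext i j
      simp [A, q₀, Matrix.one_apply]
    rw [this, Matrix.det_smul]
    simp [hr.ne']
  obtain ⟨⟨v₀, w⟩, ⟨hv₀, hw⟩, hmax⟩ :=
    hD.exists_isMaxOn ⟨q₀, hq₀⟩ (hA.matrix_det.abs.continuousOn)
  have hMdet : (A (v₀, w)).det ≠ 0 := by
    have h1 : |(A q₀).det| ≤ |(A (v₀, w)).det| := hmax hq₀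
    exact abs_pos.1 ((abs_pos.2 hdet₀).trans_le h1)
  refine ⟨v₀, hv₀, A (v₀, w), hMdet, fun i => ?_, fun z hz => ?_⟩
  · convert hw i (Set.mem_univ i) using 1
    ext j
    simp [A]
  · set M := A (v₀, w) with hM
    refine ⟨M.det⁻¹ • M.cramer (z - v₀).ofLp, fun i => ?_, ?_⟩
    · have hupd : M.updateCol i (z - v₀).ofLp = A (v₀, Function.update w i z) := by
        ext k j
        by_cases h : j = i
        · subst h; simp [A, hM]
        · simp [A, hM, h]
      have h1 : |(A (v₀, Function.update w i z)).det| ≤ |M.det| := by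
        refine hmax ⟨hv₀, fun j _ => ?_⟩
        by_cases h : j = i
        · subst h; simpa using hz
        · simpa [h] using hw j (Set.mem_univ j)
      simp only [Pi.smul_apply, smul_eq_mul, Matrix.cramer_apply, hupd, abs_mul, abs_inv]
      rw [inv_mul_le_iff₀ (abs_pos.2 hMdet), mul_one]
      exact h1
    · rw [Matrix.mulVec_smul, Matrix.mulVec_cramer, smul_smul, inv_mul_cancel₀ hMdet]
      ext i
      simp

theorem volume_image_mulVec_Icc {n : ℕ} (M : Matrix (Fin n) (Fin n) ℝ) (v : E n) {a b : ℝ}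
    (hab : a ≤ b) :
    volume ((fun c : Fin n → ℝ => v + WithLp.toLp 2 (M.mulVec c)) ''
      Set.Icc (fun _ => a) (fun _ => b)) = ENNReal.ofReal (|M.det| * (b - a) ^ n) := by
  have h1 : ((fun c : Fin n → ℝ => v + WithLp.toLp 2 (M.mulVec c)) ''
      Set.Icc (fun _ => a) (fun _ => b)) =
      (fun y => v + y) '' (WithLp.ofLp ⁻¹' (Matrix.toLin' M '' Set.Icc (fun _ => a) (fun _ => b))) := by
    ext y
    constructor
    · rintro ⟨c, hc, rfl⟩
      exact ⟨_, ⟨c, hc, rfl⟩, rfl⟩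
    · rintro ⟨y, ⟨c, hc, h⟩, rfl⟩
      refine ⟨c, hc, ?_⟩
      simp only [Matrix.toLin'_apply] at h
      simp [h]
  have h2 : MeasurableSet (Matrix.toLin' M '' Set.Icc (fun _ => a) (fun _ => b)) :=
    (isCompact_Icc.image (LinearMap.continuous_of_finiteDimensional _)).measurableSet
  rw [h1, Set.image_add_left, measure_preimage_add,
    (PiLp.volume_preserving_ofLp (Fin n)).measure_preimage h2.nullMeasurableSet,
    Measure.addHaar_image_linearMap, LinearMap.det_toLin', Real.volume_Icc_pi]
  simp [ENNReal.ofReal_mul, ENNReal.ofReal_pow (sub_nonneg.2 hab)]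

theorem dotProduct_mulVec_comm {n : ℕ} (M : Matrix (Fin n) (Fin n) ℝ) (a g : Fin n → ℝ) :
    M.mulVec a ⬝ᵥ g = ∑ i, a i * (M.transpose.mulVec g) i := by
  rw [dotProduct_comm, Matrix.dotProduct_mulVec, ← Matrix.mulVec_transpose, dotProduct_comm]
  rfl

/-- If a linear functional is bounded above by `t` on the vertices of a simplex (measured from a point
whose barycentric coordinates are at least `δ`), its values on the edges are bounded. -/
theorem abs_le_of_barycentric {ι : Type*} [Fintype ι] {a b : ι → ℝ} {δ t : ℝ} (hδ : 0 < δ)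
    (hδ1 : δ ≤ 1 / 2) (ht : 0 < t) (ha : ∀ i, δ ≤ a i) (hs : ∑ i, a i ≤ 1 / 2)
    (h0 : -∑ i, a i * b i ≤ t) (hb : ∀ i, b i - ∑ i, a i * b i ≤ t) (j : ι) :
    |b j| ≤ t / δ := by
  classical
  set d := ∑ i, a i * b i with hd
  have hd' : d ≤ (∑ i, a i) * (t + d) := by
    rw [hd, Finset.sum_mul]
    exact Finset.sum_le_sum fun i _ =>
      mul_le_mul_of_nonneg_left (by linarith [hb i]) (hδ.le.trans (ha i))
  have hdt : d ≤ t := by nlinarith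
  have h2 : 2 * t ≤ t / δ := by
    rw [le_div_iff₀ hδ]; nlinarith
  have hsplit : a j * b j + ∑ i ∈ Finset.univ.erase j, a i * b i = d :=
    Finset.add_sum_erase _ (fun i => a i * b i) (Finset.mem_univ j)
  have hsplit' : a j + ∑ i ∈ Finset.univ.erase j, a i = ∑ i, a i :=
    Finset.add_sum_erase _ a (Finset.mem_univ j)
  have hle : ∑ i ∈ Finset.univ.erase j, a i * b i ≤
      (∑ i ∈ Finset.univ.erase j, a i) * (t + d) := by
    rw [Finset.sum_mul]
    exact Finset.sum_le_sum fun i _ =>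
      mul_le_mul_of_nonneg_left (by linarith [hb i]) (hδ.le.trans (ha i))
  have haj : -t ≤ a j * b j := by nlinarith [ha j]
  rw [abs_le]
  constructor
  · rw [← neg_div, div_le_iff₀ hδ]
    by_cases hbj : 0 ≤ b j
    · nlinarith
    · nlinarith [ha j]
  · linarith [hb j]

/-- Points with small positive coordinates belong to the simplex. -/
theorem Convex.add_mulVec_mem {n : ℕ} {K : Set (E n)} (hK : Convex ℝ K) {v₀ : E n} (hv : v₀ ∈ K)
    {M : Matrix (Fin n) (Fin n) ℝ} (hM : ∀ i, v₀ + WithLp.toLp 2 (M.col i) ∈ K)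
    {a : Fin n → ℝ} (ha : ∀ i, 0 ≤ a i) (hs : ∑ i, a i ≤ 1) :
    v₀ + WithLp.toLp 2 (M.mulVec a) ∈ K := by
  have key : v₀ + WithLp.toLp 2 (M.mulVec a) =
      ∑ o : Option (Fin n), (o.elim (1 - ∑ i, a i) a) •
        (o.elim v₀ fun i => v₀ + WithLp.toLp 2 (M.col i)) := by
    rw [Fintype.sum_option]
    ext j
    simp only [Option.elim, smul_add, Finset.sum_add_distrib, ← Finset.sum_smul]
    simp [Matrix.mulVec, dotProduct, mul_comm]
    ring
  rw [key]
  refine hK.sum_mem ?_ ?_ ?_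
  · rintro (_ | i) _
    · simpa using hs
    · exact ha i
  · rw [Fintype.sum_option]; simp
  · rintro (_ | i) _
    · exact hv
    · exact hM i

theorem mem_image_inv_transpose {n : ℕ} {M : Matrix (Fin n) (Fin n) ℝ} (hM : M.det ≠ 0)
    {v q : E n} {C : ℝ}
    (h : ∀ i, |(M.transpose.mulVec (q - v).ofLp) i| ≤ C) :
    q ∈ (fun c : Fin n → ℝ => v + WithLp.toLp 2 (M.transpose⁻¹.mulVec c)) ''
      Set.Icc (fun _ => -C) (fun _ => C) := by
  have hu : IsUnit M.transpose.det := by rw [Matrix.det_transpose]; exact hM.isUnit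
  refine ⟨M.transpose.mulVec (q - v).ofLp,
    ⟨fun i => (abs_le.1 (h i)).1, fun i => (abs_le.1 (h i)).2⟩, ?_⟩
  simp only
  rw [Matrix.mulVec_mulVec, Matrix.nonsing_inv_mul _ hu, Matrix.one_mulVec]
  simp

theorem volume_image_inv_transpose {n : ℕ} (M : Matrix (Fin n) (Fin n) ℝ)
    (v : E n) {C : ℝ} (hC : 0 ≤ C) :
    volume ((fun c : Fin n → ℝ => v + WithLp.toLp 2 (M.transpose⁻¹.mulVec c)) ''
      Set.Icc (fun _ => -C) (fun _ => C)) = ENNReal.ofReal (|M.det|⁻¹ * (2 * C) ^ n) := by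
  rw [volume_image_mulVec_Icc _ _ (by linarith), Matrix.det_nonsing_inv, Matrix.det_transpose,
    Ring.inverse_eq_inv', abs_inv, sub_neg_eq_add, two_mul]

/-- Gradients of a convex function on the inner part of a simplex on which `u` lies at most `t`
above its tangent plane at `x`. -/
theorem gradVec_image_subset {n : ℕ} {u : E n → ℝ} {s K : Set (E n)} {x : E n} {t δ : ℝ}
    (hc : ConvexOn ℝ s u) (hKs : K ⊆ s) (hK : Convex ℝ K) (hd : ∀ y ∈ K, DifferentiableAt ℝ u y)
    (hx : x ∈ K) (ht : 0 < t) (hδ : 0 < δ) (hδn : n * (2 * δ) ≤ 1 / 2) (hδ1 : δ ≤ 1 / 2)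
    (hle : ∀ z ∈ K, u z ≤ u x + fderiv ℝ u x (z - x) + t) {v₀ : E n} (hv : v₀ ∈ K)
    {M : Matrix (Fin n) (Fin n) ℝ} (hM0 : M.det ≠ 0)
    (hM : ∀ i, v₀ + WithLp.toLp 2 (M.col i) ∈ K) :
    gradVec u '' ((fun c : Fin n → ℝ => v₀ + WithLp.toLp 2 (M.mulVec c)) ''
        Set.Icc (fun _ => δ) (fun _ => 2 * δ)) ⊆
      (fun c : Fin n → ℝ => gradVec u x + WithLp.toLp 2 (M.transpose⁻¹.mulVec c)) ''
        Set.Icc (fun _ => -(t / δ)) (fun _ => t / δ) := by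
  rintro _ ⟨_, ⟨a, ⟨ha1, ha2⟩, rfl⟩, rfl⟩
  have hs : ∑ i, a i ≤ 1 / 2 := by
    refine le_trans (Finset.sum_le_sum fun i _ => ha2 i) ?_
    simpa using hδn
  have hyK : v₀ + WithLp.toLp 2 (M.mulVec a) ∈ K :=
    hK.add_mulVec_mem hv hM (fun i => hδ.le.trans (ha1 i)) (by linarith)
  set y := v₀ + WithLp.toLp 2 (M.mulVec a) with hy
  have hp : ∀ z ∈ K, (z - y).ofLp ⬝ᵥ (gradVec u y - gradVec u x).ofLp ≤ t := by
    intro z hz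
    have h1 := hc.add_fderiv_le (hKs hyK) (hKs hz) (hd y hyK).hasFDerivAt
    have h2 := hc.add_fderiv_le (hKs hx) (hKs hyK) (hd x hx).hasFDerivAt
    have h3 := hle z hz
    have h4 : fderiv ℝ u x (z - x) = fderiv ℝ u x (z - y) + fderiv ℝ u x (y - x) := by
      rw [← map_add, sub_add_sub_cancel]
    rw [WithLp.ofLp_sub 2 (gradVec u y), dotProduct_sub, ← fderiv_eq_dotProduct_gradVec,
      ← fderiv_eq_dotProduct_gradVec]
    linarith
  refine mem_image_inv_transpose hM0 ?_
  set g := gradVec u y - gradVec u x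
  have h0 := hp v₀ hv
  have hi : ∀ i, _ := fun i => hp _ (hM i)
  have hcol : ∀ i, M.col i ⬝ᵥ g.ofLp = (M.transpose.mulVec g.ofLp) i := fun i => rfl
  refine abs_le_of_barycentric hδ hδ1 ht ha1 hs ?_ fun i => ?_
  · rw [← dotProduct_mulVec_comm, ← neg_dotProduct]
    simpa [hy] using h0
  · rw [← dotProduct_mulVec_comm, ← hcol, ← sub_dotProduct]
    simpa [hy] using hi i

/-- Slopes close to the gradient at `x` are attained as gradients inside the section. -/
theorem subset_gradVec_image {n : ℕ} {u : E n → ℝ} {S K : Set (E n)} {x : E n} {t δ : ℝ}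
    (hS : IsOpen S) (hK : IsCompact K) (hSK : S ⊆ K) (hd : ∀ y ∈ K, DifferentiableAt ℝ u y)
    (hx : x ∈ S) (ht : 0 < t) (hδn : n * (2 * δ) ≤ 1 / 2)
    (hge : ∀ z ∈ K, z ∉ S → u x + fderiv ℝ u x (z - x) + t ≤ u z) {v₀ : E n}
    {M : Matrix (Fin n) (Fin n) ℝ} (hM0 : M.det ≠ 0)
    (hM : ∀ z ∈ K, ∃ a : Fin n → ℝ, (∀ i, |a i| ≤ 1) ∧ z = v₀ + WithLp.toLp 2 (M.mulVec a)) :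
    (fun c : Fin n → ℝ => gradVec u x + WithLp.toLp 2 (M.transpose⁻¹.mulVec c)) ''
        Set.Icc (fun _ => -(t * δ)) (fun _ => t * δ) ⊆ gradVec u '' K := by
  rintro _ ⟨c, ⟨hc1, hc2⟩, rfl⟩
  have hu : IsUnit M.transpose.det := by rw [Matrix.det_transpose]; exact hM0.isUnit
  set q : Fin n → ℝ := M.transpose⁻¹.mulVec c with hq
  have hMq : M.transpose.mulVec q = c := by
    rw [hq, Matrix.mulVec_mulVec, Matrix.mul_nonsing_inv _ hu, Matrix.one_mulVec]
  let L : E n →L[ℝ] ℝ := fderiv ℝ u x + innerSL ℝ (WithLp.toLp 2 q : E n)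
  have hL : ∀ w : E n, L w = fderiv ℝ u x w + w.ofLp ⬝ᵥ q := by
    intro w
    simp [L, EuclideanSpace.inner_eq_star_dotProduct]
  have hcont : ContinuousOn (fun z => u z - L (z - x)) K := by
    refine ContinuousOn.sub (fun z hz => (hd z hz).continuousAt.continuousWithinAt) ?_
    fun_prop
  obtain ⟨w, hw, hmin⟩ := hK.exists_isMinOn ⟨x, hSK hx⟩ hcont
  have hwS : w ∈ S := by
    by_contra hwS
    have h1 : u w - L (w - x) ≤ u x - L (x - x) := hmin (hSK hx)
    have h2 := hge w hw hwS
    obtain ⟨a, ha, hwa⟩ := hM w hw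
    obtain ⟨b, hb, hxb⟩ := hM x (hSK hx)
    have h3 : (w - x).ofLp ⬝ᵥ q = ∑ i, (a - b) i * c i := by
      rw [← hMq, ← dotProduct_mulVec_comm, Matrix.mulVec_sub, hwa, hxb]
      simp
    have h4 : ∑ i, (a - b) i * c i ≤ ∑ i : Fin n, 2 * (t * δ) := by
      refine Finset.sum_le_sum fun i _ => ?_
      have hab : |(a - b) i| ≤ 2 := by
        have := abs_sub (a i) (b i)
        simp only [Pi.sub_apply]
        linarith [ha i, hb i]
      calc (a - b) i * c i ≤ |(a - b) i| * |c i| := by rw [← abs_mul]; exact le_abs_self _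
        _ ≤ 2 * (t * δ) := mul_le_mul hab (abs_le.2 ⟨hc1 i, hc2 i⟩) (abs_nonneg _) zero_le_two
    simp only [Finset.sum_const, Finset.card_univ, Fintype.card_fin, nsmul_eq_mul] at h4
    rw [hL, hL, sub_self, map_zero, h3, WithLp.ofLp_zero, zero_dotProduct] at h1
    have h5 : n * (2 * (t * δ)) ≤ t * (1 / 2) := by
      calc n * (2 * (t * δ)) = t * (n * (2 * δ)) := by ring
        _ ≤ t * (1 / 2) := by gcongr
    linarith
  refine ⟨w, hw, ?_⟩
  have hloc : IsLocalMin (fun z => u z - L (z - x)) w := by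
    filter_upwards [hS.mem_nhds hwS] with z hz using hmin (hSK hz)
  have hder : HasFDerivAt (fun z => u z - L (z - x)) (fderiv ℝ u w - L) w :=
    (hd w hw).hasFDerivAt.sub (L.hasFDerivAt.comp w ((hasFDerivAt_id w).sub_const x))
  have h0 := sub_eq_zero.1 (hloc.hasFDerivAt_eq_zero hder)
  ext j
  simp only [gradVec, pd, h0, hL]
  simp [hq]

/-- Bounds on the Hessian determinant transfer to bounds on the volume of gradient images. -/
theorem volume_gradVec_image_le {n : ℕ} {u : E n → ℝ} {K : Set (E n)} {Lam : ℝ}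
    (hu : ∀ y ∈ K, ContDiffAt ℝ 2 u y) (hK : MeasurableSet K)
    (hdet : ∀ y ∈ K, |(Hess u y).det| ≤ Lam) :
    volume (gradVec u '' K) ≤ ENNReal.ofReal Lam * volume K := by
  refine (addHaar_image_le_lintegral_abs_det_fderiv volume hK
    fun y hy => (hasFDerivAt_gradVec (hu y hy)).hasFDerivWithinAt).trans ?_
  rw [← setLIntegral_const]
  refine setLIntegral_mono' hK fun y hy => ENNReal.ofReal_le_ofReal ?_
  rw [det_toEuclideanCLM, Matrix.det_transpose]
  exact hdet y hy

theorem le_volume_gradVec_image {n : ℕ} {u : E n → ℝ} {K : Set (E n)} {lam : ℝ}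
    (hu : ∀ y ∈ K, ContDiffAt ℝ 2 u y) (hK : MeasurableSet K) (hinj : Set.InjOn (gradVec u) K)
    (hdet : ∀ y ∈ K, lam ≤ |(Hess u y).det|) :
    ENNReal.ofReal lam * volume K ≤ volume (gradVec u '' K) := by
  rw [← lintegral_abs_det_fderiv_eq_addHaar_image volume hK
    (fun y hy => (hasFDerivAt_gradVec (hu y hy)).hasFDerivWithinAt) hinj, ← setLIntegral_const]
  refine setLIntegral_mono' hK fun y hy => ENNReal.ofReal_le_ofReal ?_
  rw [det_toEuclideanCLM, Matrix.det_transpose]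
  exact hdet y hy

/-- Volume bounds for a section, in terms of the fixed fraction `δ`. -/
theorem volume_sq_bounds {n : ℕ} {u : E n → ℝ} {Ω S : Set (E n)} {x : E n} {t δ lam Lam : ℝ}
    (hΩ : IsOpen Ω) (hu : ContDiffOn ℝ 2 u Ω) (hc : ConvexOn ℝ (closure Ω) u)
    (hlam : 0 < lam) (hdet : DetBounds Ω u lam Lam) (hS : IsOpen S) (hSc : Convex ℝ S)
    (hcpt : IsCompact (closure S)) (hSΩ : closure S ⊆ Ω) (hx : x ∈ S) (ht : 0 < t) (hδ : 0 < δ)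
    (hδn : n * (2 * δ) ≤ 1 / 2) (hδ1 : δ ≤ 1 / 2)
    (hle : ∀ z ∈ closure S, u z ≤ u x + fderiv ℝ u x (z - x) + t)
    (hge : ∀ z ∈ closure S, z ∉ S → u x + fderiv ℝ u x (z - x) + t ≤ u z) :
    (2 * δ ^ 2) ^ n * t ^ n ≤ Lam * (volume S).toReal ^ 2 ∧
      lam * (volume S).toReal ^ 2 ≤ (8 / δ ^ 2) ^ n * t ^ n := by
  set K := closure S with hKdef
  have hKc : Convex ℝ K := hSc.closure
  have hSK : S ⊆ K := subset_closure
  have hat : ∀ y ∈ K, ContDiffAt ℝ 2 u y := fun y hy => hu.contDiffAt (hΩ.mem_nhds (hSΩ hy))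
  have hd : ∀ y ∈ K, DifferentiableAt ℝ u y := fun y hy =>
    (hat y hy).differentiableAt (by norm_num)
  have hvol : volume K = volume S := by
    have h0 : volume (K \ S) = 0 := by
      have := hSc.addHaar_frontier volume
      rwa [hS.frontier_eq] at this
    exact measure_congr ((ae_le_set.2 h0).antisymm hSK.eventuallyLE)
  have hfin : volume K ≠ ⊤ := hcpt.measure_lt_top.ne
  obtain ⟨v₀, hv₀, M, hM0, hcol, hcov⟩ := hcpt.exists_simplex
    ⟨x, interior_mono hSK (by rwa [hS.interior_eq])⟩
  rw [← hvol]
  set V := (volume K).toReal with hV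
  have hVe : volume K = ENNReal.ofReal V := (ENNReal.ofReal_toReal hfin).symm
  have hV0 : 0 ≤ V := ENNReal.toReal_nonneg
  set D := |M.det| with hD
  have hD0 : 0 < D := abs_pos.2 hM0
  set T := (fun c : Fin n → ℝ => v₀ + WithLp.toLp 2 (M.mulVec c)) ''
        Set.Icc (fun _ => δ) (fun _ => 2 * δ) with hT
  have hTvol : volume T = ENNReal.ofReal (D * δ ^ n) := by
    rw [hT, volume_image_mulVec_Icc _ _ (by linarith), two_mul, add_sub_cancel_right]
  have hTK : T ⊆ K := by
    rintro _ ⟨a, ⟨ha1, ha2⟩, rfl⟩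
    refine hKc.add_mulVec_mem hv₀ hcol (fun i => hδ.le.trans (ha1 i)) ?_
    refine le_trans (Finset.sum_le_sum fun i _ => ha2 i) ?_
    simp
    linarith
  have hTm : MeasurableSet T := by
    refine (isCompact_Icc.image ?_).measurableSet
    fun_prop
  have hVD : V ≤ D * 2 ^ n := by
    have h1 : volume K ≤ ENNReal.ofReal (D * (1 - (-1)) ^ n) := by
      rw [← volume_image_mulVec_Icc M v₀ (by norm_num)]
      refine measure_mono fun z hz => ?_
      obtain ⟨a, ha, rfl⟩ := hcov z hz
      exact ⟨a, ⟨fun i => (abs_le.1 (ha i)).1, fun i => (abs_le.1 (ha i)).2⟩, rfl⟩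
    rw [hVe, ENNReal.ofReal_le_ofReal_iff (by positivity)] at h1
    norm_num at h1
    exact h1
  have hDV : D * δ ^ n ≤ V := by
    have h1 := measure_mono (μ := volume) hTK
    rwa [hVe, hTvol, ENNReal.ofReal_le_ofReal_iff hV0] at h1
  have hpos : ∀ y ∈ K, 0 < (Hess u y).det := fun y hy => hlam.trans_le (hdet y (hSΩ hy)).1
  have hLam : 0 < Lam := (hpos x (hSK hx)).trans_le (hdet x (hSΩ (hSK hx))).2
  have hup : lam * (D * δ ^ n) ≤ D⁻¹ * (2 * (t / δ)) ^ n := by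
    have hinj : Set.InjOn (gradVec u) T :=
      (gradVec_injOn hΩ hu hc subset_closure hKc hSΩ
        fun y hy => (hlam.trans_le (hdet y hy).1).ne').mono hTK
    have h1 := (le_volume_gradVec_image (lam := lam) (fun y hy => hat y (hTK hy)) hTm hinj
      fun y hy => by
        rw [abs_of_pos (hpos y (hTK hy))]; exact (hdet y (hSΩ (hTK hy))).1).trans
      (measure_mono (gradVec_image_subset hc (hSΩ.trans subset_closure) hKc hd (hSK hx) ht hδ hδn
        hδ1 hle hv₀ hM0 hcol))
    rwa [volume_image_inv_transpose M _ (by positivity), hTvol, ← ENNReal.ofReal_mul hlam.le,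
      ENNReal.ofReal_le_ofReal_iff (by positivity)] at h1
  have hlow : D⁻¹ * (2 * (t * δ)) ^ n ≤ Lam * V := by
    have h1 := (measure_mono (subset_gradVec_image hS hcpt hSK hd hx ht hδn hge hM0 hcov)).trans
      (volume_gradVec_image_le (Lam := Lam) hat hcpt.measurableSet fun y hy => by
        rw [abs_of_pos (hpos y hy)]; exact (hdet y (hSΩ hy)).2)
    rwa [volume_image_inv_transpose M _ (by positivity), hVe, ← ENNReal.ofReal_mul hLam.le,
      ENNReal.ofReal_le_ofReal_iff (by positivity)] at h1
  constructor
  · calc (2 * δ ^ 2) ^ n * t ^ n = (D⁻¹ * (2 * (t * δ)) ^ n) * (D * δ ^ n) := by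
          field_simp
          simp only [← mul_pow]
          ring_nf
      _ ≤ (Lam * V) * V := mul_le_mul hlow hDV (by positivity) (by positivity)
      _ = Lam * V ^ 2 := by ring
  · calc lam * V ^ 2 ≤ lam * (D * 2 ^ n) ^ 2 := by gcongr
      _ = (lam * (D * δ ^ n)) * (D * 4 ^ n * (δ⁻¹) ^ n) := by
          rw [show (4 : ℝ) ^ n = 2 ^ n * 2 ^ n by rw [← mul_pow]; norm_num, inv_pow]
          field_simp
      _ ≤ (D⁻¹ * (2 * (t / δ)) ^ n) * (D * 4 ^ n * (δ⁻¹) ^ n) := by gcongr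
      _ = (8 / δ ^ 2) ^ n * t ^ n := by
          rw [show D⁻¹ * (2 * (t / δ)) ^ n * (D * 4 ^ n * δ⁻¹ ^ n) =
            (D⁻¹ * D) * ((2 * (t / δ)) ^ n * 4 ^ n * δ⁻¹ ^ n) by ring,
            inv_mul_cancel₀ hD0.ne', one_mul, ← mul_pow, ← mul_pow, ← mul_pow]
          congr 1
          field_simp
          norm_num

/-- Lemma 2.1: volume growth of compactly contained sections. -/
theorem section_volume_growth (n : ℕ) (hn : 2 ≤ n)
    (lam Lam : ℝ) (hlam : 0 < lam) (hlL : lam ≤ Lam) :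
    ∃ c₁ > 0, ∃ C₁ > 0, ∀ (Ω : Set (E n)) (u : E n → ℝ),
      MASetup Ω u → DetBounds Ω u lam Lam →
      ∀ x ∈ Ω, ∀ t : ℝ, 0 < t → CptIn (MASection Ω u x t) Ω →
        c₁ * t ^ ((n : ℝ) / 2) ≤ (volume (MASection Ω u x t)).toReal ∧
        (volume (MASection Ω u x t)).toReal ≤ C₁ * t ^ ((n : ℝ) / 2) := by
  have hn0 : (0 : ℝ) < n := by exact_mod_cast (by omega : 0 < n)
  have hn2 : (2 : ℝ) ≤ n := by exact_mod_cast hn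
  have hLam : 0 < Lam := hlam.trans_le hlL
  set δ : ℝ := 1 / (4 * n) with hδdef
  have hδ : 0 < δ := by positivity
  have hδn : n * (2 * δ) ≤ 1 / 2 := by
    rw [hδdef]; field_simp; norm_num
  have hδ1 : δ ≤ 1 / 2 := by
    nlinarith
  refine ⟨√((2 * δ ^ 2) ^ n / Lam), by positivity, √((8 / δ ^ 2) ^ n / lam), by positivity, ?_⟩
  rintro Ω u ⟨hΩ, -, -, -, hu, hc, -⟩ hdet x hx t ht ⟨hcpt, hSΩ⟩
  set S := MASection Ω u x t with hSdef
  have huΩ : ContDiffOn ℝ 2 u Ω :=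
    (hu.mono subset_closure).of_le (by norm_cast)
  have hℓ : Continuous fun z => u x + fderiv ℝ u x (z - x) + t := by fun_prop
  have hSeq : S = {z ∈ Ω | u z < u x + fderiv ℝ u x (z - x) + t} := by
    ext z
    exact ⟨fun hz => ⟨hSΩ (subset_closure hz), hz.2⟩, fun hz => ⟨subset_closure hz.1, hz.2⟩⟩
  have hSo : IsOpen S := by
    rw [hSeq]
    have h1 := (huΩ.continuousOn.sub hℓ.continuousOn).isOpen_inter_preimage hΩ
      (isOpen_Iio (a := (0 : ℝ)))
    have h2 : {z ∈ Ω | u z < u x + fderiv ℝ u x (z - x) + t} =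
        Ω ∩ (u - fun z => u x + fderiv ℝ u x (z - x) + t) ⁻¹' Set.Iio 0 := by
      ext z
      refine and_congr_right fun _ => ?_
      simp only [Set.mem_preimage, Pi.sub_apply, Set.mem_Iio, sub_neg]
    rwa [h2]
  have hSc : Convex ℝ S := by
    have h1 : ConvexOn ℝ (closure Ω) (fun z => u z - fderiv ℝ u x z) :=
      hc.sub ((fderiv ℝ u x).toLinearMap.concaveOn hc.1)
    have h2 : S = {z ∈ closure Ω | u z - fderiv ℝ u x z < u x - fderiv ℝ u x x + t} := by
      ext z
      refine and_congr_right fun _ => ?_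
      rw [map_sub]
      constructor <;> intro h <;> linarith
    rw [h2]
    exact h1.convex_lt _
  have hxS : x ∈ S := ⟨subset_closure hx, by simpa using ht⟩
  have hle : ∀ z ∈ closure S, u z ≤ u x + fderiv ℝ u x (z - x) + t := fun z hz =>
    ContinuousWithinAt.closure_le hz
      ((huΩ.continuousOn.continuousAt (hΩ.mem_nhds (hSΩ hz))).continuousWithinAt)
      hℓ.continuousWithinAt fun y hy => hy.2.le
  have hge : ∀ z ∈ closure S, z ∉ S → u x + fderiv ℝ u x (z - x) + t ≤ u z := by
    intro z hz hzS
    by_contra! h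
    exact hzS ⟨subset_closure (hSΩ hz), h⟩
  obtain ⟨h1, h2⟩ := volume_sq_bounds hΩ huΩ hc hlam hdet hSo hSc hcpt hSΩ hxS ht hδ hδn hδ1 hle hge
  have htn : t ^ ((n : ℝ) / 2) = √(t ^ n) := by
    rw [Real.sqrt_eq_rpow, ← Real.rpow_natCast, ← Real.rpow_mul ht.le]
    ring_nf
  rw [htn, ← Real.sqrt_mul (by positivity), ← Real.sqrt_mul (by positivity)]
  constructor
  · refine Real.sqrt_le_iff.2 ⟨ENNReal.toReal_nonneg, ?_⟩
    rw [div_mul_eq_mul_div, div_le_iff₀ hLam]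
    linarith
  · refine Real.le_sqrt_of_sq_le ?_
    rw [div_mul_eq_mul_div, le_div_iff₀ hlam]
    linarith
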